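/- arXiv:2504.07629 — 2 statements merged into one kernel-verified Lean document; each statement's English description precedes it below -/
import Mathlib

section
/- Let α, β : ℝ³ → ℝ be continuously differentiable with α − β equal to a constant c satisfying |c| > 2, and set λ₁ = (α + β + √(c² − 4))/2 and λ₂ = (α + β − √(c² − 4))/2. Let u, B : ℝ³ → ℝ³ be twice continuously differentiable with div u = 0, div B = 0, B + curl u = α u, and u − curl B = −β B pointwise on ℝ³. Then there exist vector fields u₁, u₂, B₁, B₂ : ℝ³ → ℝ³ with div u_i = 0, div B_i = 0, curl u_i = λ_i u_i, curl B_i = λ_i B_i for i = 1, 2, such that u = u₁ + u₂ and B = B₁ + B₂. Explicitly, one may take u₁ = (curl u − λ₂ u)/(λ₁ − λ₂) and u₂ = −(curl u − λ₁ u)/(λ₁ − λ₂), and similarly for B. -/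
noncomputable section

open Real MeasureTheory

/-- ℝ³ as coordinate functions. -/
abbrev V3 : Type := Fin 3 → ℝ

/-- Partial derivative in the `i`-th coordinate direction. -/
noncomputable def pd (i : Fin 3) (f : V3 → ℝ) (x : V3) : ℝ :=
  fderiv ℝ f x (Pi.single i 1)

/-- Curl of a vector field on ℝ³:
`curl v = (∂₂v₃ − ∂₃v₂, ∂₃v₁ − ∂₁v₃, ∂₁v₂ − ∂₂v₁)`. -/
noncomputable def curl (v : V3 → V3) (x : V3) : V3 :=
  ![pd 1 (fun y => v y 2) x - pd 2 (fun y => v y 1) x,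
    pd 2 (fun y => v y 0) x - pd 0 (fun y => v y 2) x,
    pd 0 (fun y => v y 1) x - pd 1 (fun y => v y 0) x]

/-- Divergence of a vector field on ℝ³. -/
noncomputable def div3 (v : V3 → V3) (x : V3) : ℝ :=
  pd 0 (fun y => v y 0) x + pd 1 (fun y => v y 1) x + pd 2 (fun y => v y 2) x

/-- Gradient of a scalar function on ℝ³. -/
noncomputable def grad (f : V3 → ℝ) (x : V3) : V3 :=
  ![pd 0 f x, pd 1 f x, pd 2 f x]

/-- Cross product on ℝ³. -/
def cross (a b : V3) : V3 :=
  ![a 1 * b 2 - a 2 * b 1, a 2 * b 0 - a 0 * b 2, a 0 * b 1 - a 1 * b 0]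

/-- Componentwise Laplacian of a vector field. -/
noncomputable def lap (v : V3 → V3) (x : V3) : V3 :=
  fun j => ∑ i : Fin 3, pd i (fun y => pd i (fun z => v z j) y) x

/-- Advection term `((u·∇)w)_j = Σ_i u_i ∂_i w_j`. -/
noncomputable def adv (u w : V3 → V3) (x : V3) : V3 :=
  fun j => ∑ i : Fin 3, u x i * pd i (fun y => w y j) x

/-- Time derivative of a time-dependent vector field. -/
noncomputable def dt (u : ℝ → V3 → V3) (t : ℝ) (x : V3) : V3 :=
  fun j => deriv (fun s => u s x j) t

/-- The partial derivative of a linear combination. -/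
theorem pd_comb (i j : Fin 3) (u B : V3 → V3) (hu : Differentiable ℝ u) (hB : Differentiable ℝ B)
    (a b : ℝ) (x : V3) :
    pd i (fun y => (a • u y + b • B y) j) x
      = a * pd i (fun y => u y j) x + b * pd i (fun y => B y j) x := by
  have h1 : DifferentiableAt ℝ (fun y => u y j) x := differentiableAt_pi.1 (hu x) j
  have h2 : DifferentiableAt ℝ (fun y => B y j) x := differentiableAt_pi.1 (hB x) j
  have h : HasFDerivAt (fun y => (a • u y + b • B y) j)
      (a • fderiv ℝ (fun y => u y j) x + b • fderiv ℝ (fun y => B y j) x) x :=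
    (h1.hasFDerivAt.const_smul a).add (h2.hasFDerivAt.const_smul b)
  unfold pd
  rw [h.fderiv]
  simp

theorem div3_comb (u B : V3 → V3) (hu : Differentiable ℝ u) (hB : Differentiable ℝ B)
    (a b : ℝ) (x : V3) :
    div3 (fun y => a • u y + b • B y) x = a * div3 u x + b * div3 B x := by
  unfold div3
  simp only [pd_comb _ _ u B hu hB]
  ring

theorem curl_comb (u B : V3 → V3) (hu : Differentiable ℝ u) (hB : Differentiable ℝ B)
    (a b : ℝ) (x : V3) :
    curl (fun y => a • u y + b • B y) x = a • curl u x + b • curl B x := by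
  unfold curl
  simp only [pd_comb _ _ u B hu hB]
  ext k
  fin_cases k <;> simp <;> ring

/-- Theorem 2.2 (2): when `α − β = c` is constant with `|c| > 2`, every
double Beltrami state decomposes as a superposition of two Beltrami flows with
factors `λ₁, λ₂`. -/
theorem double_beltrami_decomposition
    (α β : V3 → ℝ) (c : ℝ)
    (hα : ContDiff ℝ 1 α) (hβ : ContDiff ℝ 1 β)
    (hc : ∀ x, α x - β x = c) (hc2 : 2 < |c|)
    (l1 l2 : V3 → ℝ)
    (hl1 : ∀ x, l1 x = (α x + β x + Real.sqrt (c ^ 2 - 4)) / 2)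
    (hl2 : ∀ x, l2 x = (α x + β x - Real.sqrt (c ^ 2 - 4)) / 2)
    (u B : V3 → V3)
    (hu : ContDiff ℝ 2 u) (hB : ContDiff ℝ 2 B)
    (hdivu : ∀ x, div3 u x = 0) (hdivB : ∀ x, div3 B x = 0)
    (h1 : ∀ x, B x + curl u x = α x • u x)
    (h2 : ∀ x, u x - curl B x = -(β x) • B x) :
    ∃ u1 u2 B1 B2 : V3 → V3,
      (∀ x, div3 u1 x = 0) ∧ (∀ x, div3 u2 x = 0) ∧
      (∀ x, div3 B1 x = 0) ∧ (∀ x, div3 B2 x = 0) ∧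
      (∀ x, curl u1 x = l1 x • u1 x) ∧ (∀ x, curl u2 x = l2 x • u2 x) ∧
      (∀ x, curl B1 x = l1 x • B1 x) ∧ (∀ x, curl B2 x = l2 x • B2 x) ∧
      (∀ x, u x = u1 x + u2 x) ∧ (∀ x, B x = B1 x + B2 x) ∧
      (∀ x, u1 x = (l1 x - l2 x)⁻¹ • (curl u x - l2 x • u x)) ∧
      (∀ x, u2 x = -((l1 x - l2 x)⁻¹ • (curl u x - l1 x • u x))) ∧
      (∀ x, B1 x = (l1 x - l2 x)⁻¹ • (curl B x - l2 x • B x)) ∧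
      (∀ x, B2 x = -((l1 x - l2 x)⁻¹ • (curl B x - l1 x • B x))) := by
  have hdu : Differentiable ℝ u := hu.differentiable (by norm_num)
  have hdB : Differentiable ℝ B := hB.differentiable (by norm_num)
  have hcc : 0 < c ^ 2 - 4 := by
    have := sq_abs c
    nlinarith
  obtain ⟨s, hs⟩ : ∃ s, s = Real.sqrt (c ^ 2 - 4) := ⟨_, rfl⟩
  have hs0 : 0 < s := hs ▸ Real.sqrt_pos.2 hcc
  have hs2 : s ^ 2 = c ^ 2 - 4 := by rw [hs, Real.sq_sqrt hcc.le]
  rw [← hs] at hl1 hl2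
  have hcu : ∀ x, curl u x = α x • u x - B x := fun x => by rw [← h1 x]; abel
  have hcB : ∀ x, curl B x = u x + β x • B x := fun x => by
    have := h2 x
    rw [neg_smul, sub_eq_iff_eq_add] at this
    rw [this]; abel
  have hα' : ∀ x, α x = β x + c := fun x => by linarith [hc x]
  have hd : ∀ x, l1 x - l2 x = s := fun x => by rw [hl1, hl2]; ring
  have hsn := hs0.ne'
  have hdiv : ∀ a b : ℝ, ∀ x, div3 (fun y => a • u y + b • B y) x = 0 := fun a b x => by
    rw [div3_comb u B hdu hdB, hdivu, hdivB]; ring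
  have hcurl : ∀ (a b : ℝ) (l : V3 → ℝ) (x : V3), a * α x + b = l x * a → -a + b * β x = l x * b →
      curl (fun y => a • u y + b • B y) x = l x • (a • u x + b • B x) := by
    intro a b l x e1 e2
    rw [curl_comb u B hdu hdB, hcu, hcB]
    ext k
    simp only [Pi.add_apply, Pi.sub_apply, Pi.smul_apply, smul_eq_mul]
    linear_combination u x k * e1 + B x k * e2
  refine ⟨fun y => ((c + s) / 2 / s) • u y + (-1 / s) • B y,
    fun y => (-(c - s) / 2 / s) • u y + (1 / s) • B y,
    fun y => (1 / s) • u y + ((s - c) / 2 / s) • B y,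
    fun y => (-1 / s) • u y + ((s + c) / 2 / s) • B y,
    hdiv _ _, hdiv _ _, hdiv _ _, hdiv _ _,
    fun x => hcurl _ _ l1 x ?_ ?_, fun x => hcurl _ _ l2 x ?_ ?_,
    fun x => hcurl _ _ l1 x ?_ ?_, fun x => hcurl _ _ l2 x ?_ ?_,
    fun x => ?_, fun x => ?_, fun x => ?_, fun x => ?_, fun x => ?_, fun x => ?_⟩
  all_goals first
    | (simp only [hl1, hl2, hα']
       field_simp
       first
         | ring1
         | linear_combination hs2
         | linear_combination -hs2
         | linear_combination 2 * hs2
         | linear_combination -2 * hs2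
         | linear_combination hs2 / 2
         | linear_combination -hs2 / 2)
    | (ext k
       try rw [hd]
       simp only [hcu, hcB, hl1, hl2, hα', Pi.add_apply, Pi.sub_apply, Pi.neg_apply,
         Pi.smul_apply, smul_eq_mul]
       field_simp
       ring1)
end
end

section
/- Let T > 0, let X : [0, T] → [0, ∞) be differentiable, let D, W, E : [0, T] → [0, ∞) be integrable, and let C₀ > 0 and λ > 0 be constants such that X'(t) + D(t) ≤ W(t) X(t) + C₀ X(t)^λ D(t) + E(t) for all t ∈ [0, T]. If (X(0) + ∫₀ᵀ E(τ) dτ) · exp(∫₀ᵀ W(τ) dτ) < (1/(2C₀))^{1/λ}, then for every t ∈ [0, T], X(t) + (1/2) ∫₀ᵗ D(τ) dτ ≤ (X(0) + ∫₀ᵗ E(τ) dτ) · exp(∫₀ᵗ W(τ) dτ). -/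
open MeasureTheory

lemma aux_exp_neg_lip {a b : ℝ} (ha : 0 ≤ a) (hb : 0 ≤ b) :
    |Real.exp (-a) - Real.exp (-b)| ≤ |a - b| := by
  wlog hab : a ≤ b generalizing a b
  · rw [abs_sub_comm, abs_sub_comm a b]
    exact this hb ha (le_of_not_ge hab)
  have h1 : Real.exp (-b) ≤ Real.exp (-a) := Real.exp_le_exp.mpr (by linarith)
  rw [abs_of_nonneg (by linarith), abs_of_nonpos (by linarith)]
  have h2 : Real.exp (-b) = Real.exp (-a) * Real.exp (-(b - a)) := by
    rw [← Real.exp_add]; congr 1; ring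
  have h3 := Real.add_one_le_exp (-(b - a))
  have h4 : Real.exp (-a) ≤ 1 := Real.exp_le_one_iff.mpr (by linarith)
  have h5 := Real.exp_pos (-a)
  rw [h2]
  nlinarith

lemma aux_ac_exp {w : ℝ → ℝ} {a b : ℝ} (hw : AbsolutelyContinuousOnInterval w a b)
    (hnn : ∀ x ∈ Set.uIcc a b, 0 ≤ w x) :
    AbsolutelyContinuousOnInterval (fun x => Real.exp (-(w x))) a b := by
  rw [absolutelyContinuousOnInterval_iff] at hw ⊢
  intro ε hε
  obtain ⟨δ, hδ, h⟩ := hw ε hε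
  refine ⟨δ, hδ, fun E hE hl => lt_of_le_of_lt (Finset.sum_le_sum fun i hi => ?_) (h E hE hl)⟩
  have := hE.1 i hi
  exact aux_exp_neg_lip (hnn _ this.1) (hnn _ this.2)

/-- Integral Grönwall inequality with an integrable kernel. -/
lemma aux_gronwall {Y W : ℝ → ℝ} {A s : ℝ} (hs : 0 ≤ s)
    (hY : ContinuousOn Y (Set.Icc 0 s)) (hW : IntervalIntegrable W volume 0 s)
    (hWnn : ∀ t ∈ Set.Icc 0 s, 0 ≤ W t)
    (h : ∀ t ∈ Set.Icc 0 s, Y t ≤ A + ∫ τ in (0:ℝ)..t, W τ * Y τ) :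
    Y s ≤ A * Real.exp (∫ τ in (0:ℝ)..s, W τ) := by
  have hI : Set.uIcc 0 s = Set.Icc 0 s := Set.uIcc_of_le hs
  have h0 : (0:ℝ) ∈ Set.uIcc 0 s := by simp
  have hWY : IntervalIntegrable (fun τ => W τ * Y τ) volume 0 s :=
    hW.mul_continuousOn (by rwa [hI])
  have acw := hW.absolutelyContinuousOnInterval_intervalIntegral h0
  have acv := hWY.absolutelyContinuousOnInterval_intervalIntegral h0
  have wnn : ∀ x ∈ Set.uIcc 0 s, 0 ≤ ∫ τ in (0:ℝ)..x, W τ := by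
    intro x hx
    rw [hI] at hx
    exact intervalIntegral.integral_nonneg hx.1 fun u hu => hWnn u ⟨hu.1, hu.2.trans hx.2⟩
  have acg := aux_ac_exp acw wnn
  have acZ : AbsolutelyContinuousOnInterval (fun t => A + ∫ τ in (0:ℝ)..t, W τ * Y τ) 0 s := by
    rw [absolutelyContinuousOnInterval_iff] at acv ⊢
    simpa using acv
  have key := acZ.integral_deriv_mul_eq_sub acg
  have hle : ∫ x in (0:ℝ)..s, (deriv (fun t => A + ∫ τ in (0:ℝ)..t, W τ * Y τ) x *
      Real.exp (-(∫ τ in (0:ℝ)..x, W τ)) + (A + ∫ τ in (0:ℝ)..x, W τ * Y τ) *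
      deriv (fun x => Real.exp (-(∫ τ in (0:ℝ)..x, W τ))) x) ≤ 0 := by
    rw [intervalIntegral.integral_of_le hs]
    apply integral_nonpos_of_ae
    rw [Filter.EventuallyLE, ae_restrict_iff' measurableSet_Ioc]
    filter_upwards [hW.ae_hasDerivAt_integral, hWY.ae_hasDerivAt_integral] with x h1 h2 hx
    have hx' : x ∈ Set.Icc 0 s := Set.Ioc_subset_Icc_self hx
    have d1 := h1 (hI ▸ hx') 0 h0
    have d2 := h2 (hI ▸ hx') 0 h0
    rw [(d2.const_add A).deriv, d1.fun_neg.exp.deriv]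
    have e1 := h x hx'
    have e2 := hWnn x hx'
    have e3 := Real.exp_pos (-(∫ τ in (0:ℝ)..x, W τ))
    have e4 : 0 ≤ (W x * Real.exp (-(∫ τ in (0:ℝ)..x, W τ))) *
      ((A + ∫ τ in (0:ℝ)..x, W τ * Y τ) - Y x) := mul_nonneg (by positivity) (by linarith)
    simp only [Pi.zero_apply]
    linarith
  rw [key] at hle
  simp only [intervalIntegral.integral_same, add_zero, neg_zero, Real.exp_zero, mul_one] at hle
  have hfin := h s ⟨hs, le_rfl⟩
  rw [Real.exp_neg] at hle
  have e3 := Real.exp_pos (∫ τ in (0:ℝ)..s, W τ)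
  refine hfin.trans ?_
  rw [← div_eq_mul_inv, sub_nonpos, div_le_iff₀ e3] at hle
  exact hle

lemma aux_step
    (T : ℝ)
    (X D W E : ℝ → ℝ) (C0 lam : ℝ) (hC0 : 0 < C0) (hlam : 0 < lam)
    (hXnn : ∀ t ∈ Set.Icc (0 : ℝ) T, 0 ≤ X t)
    (hDnn : ∀ t ∈ Set.Icc (0 : ℝ) T, 0 ≤ D t)
    (hWnn : ∀ t ∈ Set.Icc (0 : ℝ) T, 0 ≤ W t)
    (hEnn : ∀ t ∈ Set.Icc (0 : ℝ) T, 0 ≤ E t)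
    (hXdiff : DifferentiableOn ℝ X (Set.Icc 0 T))
    (hDint : IntegrableOn D (Set.Icc 0 T))
    (hWint : IntegrableOn W (Set.Icc 0 T))
    (hEint : IntegrableOn E (Set.Icc 0 T))
    (hineq : ∀ t ∈ Set.Icc (0 : ℝ) T,
      derivWithin X (Set.Icc 0 T) t + D t ≤ W t * X t + C0 * X t ^ lam * D t + E t)
    (s : ℝ) (hs : s ∈ Set.Icc 0 T)
    (hM : ∀ t ∈ Set.Icc 0 s, X t ≤ (1 / (2 * C0)) ^ (1 / lam)) :
    X s + (1 / 2) * ∫ τ in (0:ℝ)..s, D τ ≤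
        (X 0 + ∫ τ in (0:ℝ)..s, E τ) * Real.exp (∫ τ in (0:ℝ)..s, W τ) := by
  have sub : ∀ {t}, t ∈ Set.Icc 0 s → Set.Icc 0 t ⊆ Set.Icc 0 T := fun ht =>
    Set.Icc_subset_Icc le_rfl (ht.2.trans hs.2)
  have hss : s ∈ Set.Icc 0 s := ⟨hs.1, le_rfl⟩
  have ii : ∀ {f : ℝ → ℝ}, IntegrableOn f (Set.Icc 0 T) → ∀ {t}, t ∈ Set.Icc 0 s →
      IntervalIntegrable f volume 0 t := by
    intro f hf t ht
    rw [intervalIntegrable_iff_integrableOn_Icc_of_le ht.1]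
    exact hf.mono_set (sub ht)
  have hXc : ContinuousOn X (Set.Icc 0 T) := hXdiff.continuousOn
  have hYc : ContinuousOn (fun t => X t + (1 / 2) * ∫ τ in (0:ℝ)..t, D τ) (Set.Icc 0 s) := by
    refine (hXc.mono (sub hss)).add (continuousOn_const.mul ?_)
    have := ((ii hDint hss).absolutelyContinuousOnInterval_intervalIntegral
      (c := 0) (by simp)).continuousOn
    rwa [Set.uIcc_of_le hs.1] at this
  refine aux_gronwall hs.1 hYc (ii hWint hss) (fun t ht => hWnn t (sub hss ht)) ?_
  intro t ht
  have iWX : IntervalIntegrable (fun τ => W τ * X τ) volume 0 t :=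
    (ii hWint ht).mul_continuousOn (by rw [Set.uIcc_of_le ht.1]; exact hXc.mono (sub ht))
  have iWY : IntervalIntegrable (fun τ => W τ * (X τ + (1 / 2) * ∫ τ in (0:ℝ)..τ, D τ)) volume 0 t :=
    (ii hWint ht).mul_continuousOn (by
      rw [Set.uIcc_of_le ht.1]; exact hYc.mono (Set.Icc_subset_Icc le_rfl ht.2))
  have iE := ii hEint ht
  have iD := ii hDint ht
  have main : X t - X 0 ≤ ∫ τ in (0:ℝ)..t, (W τ * X τ + E τ - (1/2) * D τ) := by
    refine intervalIntegral.sub_le_integral_of_hasDeriv_right_of_le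
      (g' := fun τ => derivWithin X (Set.Icc 0 T) τ) ht.1 (hXc.mono (sub ht)) ?_ ?_ ?_
    · intro x hx
      have hx' : x ∈ Set.Icc 0 T := sub ht (Set.Ioo_subset_Icc_self hx)
      have hxT : x < T := hx.2.trans_le (ht.2.trans hs.2)
      have := (hXdiff x hx').hasDerivWithinAt
      exact (this.hasDerivAt (Icc_mem_nhds hx.1 hxT)).hasDerivWithinAt
    · rw [← intervalIntegrable_iff_integrableOn_Icc_of_le ht.1]
      exact (iWX.add iE).sub (iD.const_mul _)
    · intro x hx
      have hx' : x ∈ Set.Icc 0 T := sub ht (Set.Ioo_subset_Icc_self hx)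
      have h1 := hineq x hx'
      have h2 : X x ^ lam ≤ 1 / (2 * C0) := by
        have := Real.rpow_le_rpow (hXnn x hx') (hM x ⟨hx.1.le, hx.2.le.trans ht.2⟩) hlam.le
        rwa [← Real.rpow_mul (by positivity), one_div_mul_cancel hlam.ne', Real.rpow_one] at this
      have h3 : C0 * X x ^ lam ≤ 1 / 2 := by
        calc _ ≤ C0 * (1 / (2 * C0)) := by gcongr
          _ = _ := by field_simp
      have h4 := mul_le_mul_of_nonneg_right h3 (hDnn x hx')
      linarith
  rw [intervalIntegral.integral_sub (iWX.add iE) (iD.const_mul _),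
    intervalIntegral.integral_add iWX iE, intervalIntegral.integral_const_mul] at main
  have m1 : ∫ τ in (0:ℝ)..t, W τ * X τ ≤
      ∫ τ in (0:ℝ)..t, W τ * (X τ + (1 / 2) * ∫ τ in (0:ℝ)..τ, D τ) := by
    refine intervalIntegral.integral_mono_on ht.1 iWX iWY fun x hx => ?_
    refine mul_le_mul_of_nonneg_left ?_ (hWnn x (sub ht hx))
    have : 0 ≤ ∫ τ in (0:ℝ)..x, D τ := intervalIntegral.integral_nonneg hx.1 fun u hu =>
      hDnn u (sub ht ⟨hu.1, hu.2.trans hx.2⟩)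
    linarith
  have m2 : ∫ τ in (0:ℝ)..t, E τ ≤ ∫ τ in (0:ℝ)..s, E τ := by
    refine intervalIntegral.integral_mono_interval le_rfl ht.1 ht.2 ?_ (ii hEint hss)
    filter_upwards [ae_restrict_mem measurableSet_Ioc] with x hx
    exact hEnn x (sub hss (Set.Ioc_subset_Icc_self hx))
  linarith

/-- Grönwall-type lemma, \cite[Lemma A.4]{Danchin Tan 3}. -/
theorem gronwall_type_lemma
    (T : ℝ) (hT : 0 < T)
    (X D W E : ℝ → ℝ) (C0 lam : ℝ) (hC0 : 0 < C0) (hlam : 0 < lam)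
    (hXnn : ∀ t ∈ Set.Icc (0 : ℝ) T, 0 ≤ X t)
    (hDnn : ∀ t ∈ Set.Icc (0 : ℝ) T, 0 ≤ D t)
    (hWnn : ∀ t ∈ Set.Icc (0 : ℝ) T, 0 ≤ W t)
    (hEnn : ∀ t ∈ Set.Icc (0 : ℝ) T, 0 ≤ E t)
    (hXdiff : DifferentiableOn ℝ X (Set.Icc 0 T))
    (hDint : IntegrableOn D (Set.Icc 0 T))
    (hWint : IntegrableOn W (Set.Icc 0 T))
    (hEint : IntegrableOn E (Set.Icc 0 T))
    (hineq : ∀ t ∈ Set.Icc (0 : ℝ) T,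
      derivWithin X (Set.Icc 0 T) t + D t ≤ W t * X t + C0 * X t ^ lam * D t + E t)
    (hsmall : (X 0 + ∫ τ in Set.Icc (0 : ℝ) T, E τ) *
        Real.exp (∫ τ in Set.Icc (0 : ℝ) T, W τ) < (1 / (2 * C0)) ^ (1 / lam)) :
    ∀ t ∈ Set.Icc (0 : ℝ) T,
      X t + (1 / 2) * ∫ τ in Set.Icc (0 : ℝ) t, D τ ≤
        (X 0 + ∫ τ in Set.Icc (0 : ℝ) t, E τ) *
          Real.exp (∫ τ in Set.Icc (0 : ℝ) t, W τ) := by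
  have conv : ∀ (f : ℝ → ℝ) (t : ℝ), t ∈ Set.Icc 0 T →
      ∫ τ in Set.Icc (0:ℝ) t, f τ = ∫ τ in (0:ℝ)..t, f τ := by
    intro f t ht
    rw [intervalIntegral.integral_of_le ht.1, integral_Icc_eq_integral_Ioc]
  have hTT : T ∈ Set.Icc 0 T := ⟨hT.le, le_rfl⟩
  have h0T : (0:ℝ) ∈ Set.Icc 0 T := ⟨le_rfl, hT.le⟩
  rw [conv E T hTT, conv W T hTT] at hsmall
  have step := aux_step T X D W E C0 lam hC0 hlam hXnn hDnn hWnn hEnn hXdiff hDint hWint hEint hineq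
  have mono : ∀ f : ℝ → ℝ, IntegrableOn f (Set.Icc 0 T) → (∀ t ∈ Set.Icc 0 T, 0 ≤ f t) →
      ∀ s ∈ Set.Icc 0 T, ∫ τ in (0:ℝ)..s, f τ ≤ ∫ τ in (0:ℝ)..T, f τ := by
    intro f hf hnn s hs
    refine intervalIntegral.integral_mono_interval le_rfl hs.1 hs.2 ?_
      ((intervalIntegrable_iff_integrableOn_Icc_of_le hT.le).mpr hf)
    filter_upwards [ae_restrict_mem measurableSet_Ioc] with x hx
    exact hnn x (Set.Ioc_subset_Icc_self hx)
  have nn : ∀ f : ℝ → ℝ, (∀ t ∈ Set.Icc 0 T, 0 ≤ f t) →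
      ∀ s ∈ Set.Icc 0 T, 0 ≤ ∫ τ in (0:ℝ)..s, f τ := by
    intro f hnn s hs
    exact intervalIntegral.integral_nonneg hs.1 fun u hu => hnn u ⟨hu.1, hu.2.trans hs.2⟩
  have bound : ∀ s ∈ Set.Icc 0 T,
      (X 0 + ∫ τ in (0:ℝ)..s, E τ) * Real.exp (∫ τ in (0:ℝ)..s, W τ) <
        (1 / (2 * C0)) ^ (1 / lam) := by
    intro s hs
    refine lt_of_le_of_lt ?_ hsmall
    have a1 := mono E hEint hEnn s hs
    have a2 := mono W hWint hWnn s hs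
    have a3 := nn E hEnn T hTT
    have a4 := hXnn 0 h0T
    exact mul_le_mul (by linarith) (Real.exp_le_exp.mpr a2) (Real.exp_pos _).le (by linarith)
  set M := (1 / (2 * C0)) ^ (1 / lam) with hMdef
  have hX0 : X 0 < M := by simpa using bound 0 h0T
  have small : ∀ t ∈ Set.Icc 0 T, X t < M := by
    by_contra! hcon
    obtain ⟨t, ht, htM⟩ := hcon
    have hcl : IsCompact (Set.Icc 0 T ∩ X ⁻¹' Set.Ici M) :=
      isCompact_Icc.of_isClosed_subset
        (hXdiff.continuousOn.preimage_isClosed_of_isClosed isClosed_Icc isClosed_Ici)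
        Set.inter_subset_left
    obtain ⟨s, ⟨hs, hsM⟩, hleast⟩ := hcl.exists_isLeast ⟨t, ht, htM⟩
    have hlt : ∀ u ∈ Set.Ico 0 s, X u < M := by
      intro u hu
      by_contra! hc
      exact absurd (hleast ⟨⟨hu.1, hu.2.le.trans hs.2⟩, hc⟩) (not_le.mpr hu.2)
    have hXs : X s = M := by
      obtain ⟨u, hu, huM⟩ := intermediate_value_Icc hs.1
        (hXdiff.continuousOn.mono (Set.Icc_subset_Icc le_rfl hs.2)) ⟨hX0.le, hsM⟩
      rcases hu.2.eq_or_lt with rfl | h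
      · exact huM
      · exact absurd huM (hlt u ⟨hu.1, h⟩).ne
    have := step s hs (fun u hu => by
      rcases hu.2.eq_or_lt with rfl | h
      · exact hXs.le
      · exact (hlt u ⟨hu.1, h⟩).le)
    have b := bound s hs
    have d := nn D hDnn s hs
    linarith
  intro t ht
  rw [conv D t ht, conv E t ht, conv W t ht]
  exact step t ht fun u hu => (small u ⟨hu.1, hu.2.trans ht.2⟩).le
end
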